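/- The series ∑_{n=0}^∞ ((1/2)_n (1/3)_n (2/3)_n)/((1)_n^3) · (5n+1) · (-9/16)^n equals 4√3/(3π). -/

import Mathlib

open Real

noncomputable def poch (a : ℝ) (n : ℕ) : ℝ := (ascPochhammer ℝ n).eval a

open Filter Topology

theorem poch_zero (a : ℝ) : poch a 0 = 1 := by simp [poch]

theorem poch_succ (a : ℝ) (n : ℕ) : poch a (n+1) = poch a n * (a + n) := by
  simp [poch, ascPochhammer_succ_eval]

theorem poch_pos (a : ℝ) (ha : 0 < a) (n : ℕ) : 0 < poch a n := by
  induction n with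
  | zero => simp [poch_zero]
  | succ n ih => rw [poch_succ]; positivity

/-- power series -/
noncomputable def PS (a : ℕ → ℝ) (x : ℝ) : ℝ := ∑' n, a n * x ^ n

/-- polynomially bounded coefficients -/
def PB (a : ℕ → ℝ) : Prop := ∃ C : ℝ, ∃ k : ℕ, 0 ≤ C ∧ ∀ n : ℕ, |a n| ≤ C * ((n:ℝ)+1)^k

/-- coefficients of the derivative -/
def DC (a : ℕ → ℝ) : ℕ → ℝ := fun n => ((n:ℝ)+1) * a (n+1)

theorem summable_aux (k : ℕ) (r : ℝ) (h0 : 0 ≤ r) (h1 : r < 1) :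
    Summable (fun n : ℕ => ((n:ℝ)+1)^k * r^n) := by
  rcases h0.eq_or_lt with h | h
  · subst h
    apply summable_of_ne_finset_zero (s := {0})
    intro b hb
    have : b ≠ 0 := by simpa using hb
    simp [this]
  · have h2 := summable_pow_mul_geometric_of_norm_lt_one (R := ℝ) k (r := r)
      (by rw [Real.norm_eq_abs, abs_of_nonneg h0]; exact h1)
    have h3 := (summable_nat_add_iff 1).2 h2
    have h4 := h3.mul_right r⁻¹
    refine h4.congr ?_
    intro n
    push_cast
    field_simp
    ring

theorem PB.summable {a : ℕ → ℝ} (h : PB a) {x : ℝ} (hx : |x| < 1) :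
    Summable (fun n => a n * x^n) := by
  obtain ⟨C, k, hC, hb⟩ := h
  refine Summable.of_norm_bounded ((summable_aux k |x| (abs_nonneg x) hx).mul_left C) ?_
  intro n
  rw [Real.norm_eq_abs, abs_mul, abs_pow, ← mul_assoc]
  exact mul_le_mul_of_nonneg_right (hb n) (by positivity)

theorem PB.hasSum {a : ℕ → ℝ} (h : PB a) {x : ℝ} (hx : |x| < 1) :
    HasSum (fun n => a n * x^n) (PS a x) := (h.summable hx).hasSum

theorem PB.dc {a : ℕ → ℝ} (h : PB a) : PB (DC a) := by
  obtain ⟨C, k, hC, hb⟩ := h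
  refine ⟨C * 2^k, k+1, by positivity, ?_⟩
  intro n
  have h1 := hb (n+1)
  push_cast at h1
  rw [DC, abs_mul, abs_of_nonneg (by positivity : (0:ℝ) ≤ (n:ℝ)+1)]
  have h2 : ((n:ℝ)+1+1)^k ≤ (2*((n:ℝ)+1))^k := by
    gcongr; linarith [(Nat.cast_nonneg n : (0:ℝ) ≤ n)]
  rw [mul_pow] at h2
  calc ((n:ℝ)+1) * |a (n+1)| ≤ ((n:ℝ)+1) * (C * (2^k * ((n:ℝ)+1)^k)) := by
        apply mul_le_mul_of_nonneg_left _ (by positivity)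
        exact h1.trans (mul_le_mul_of_nonneg_left h2 hC)
    _ = _ := by ring

theorem PS_zero (a : ℕ → ℝ) : PS a 0 = a 0 := by
  rw [PS, tsum_eq_single 0]
  · simp
  · intro b hb; simp [hb]

theorem PB.theta {a : ℕ → ℝ} (h : PB a) {x : ℝ} (hx : |x| < 1) :
    HasSum (fun n : ℕ => ((n:ℝ) * a n) * x^n) (x * PS (DC a) x) := by
  rw [← hasSum_nat_add_iff' 1]
  simp only [Finset.sum_range_one, Nat.cast_zero, zero_mul, sub_zero]
  have := (h.dc.hasSum hx).mul_left x
  refine this.congr_fun ?_ 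
  intro n
  simp only [DC]; push_cast; ring

theorem PB.hasDerivAt {a : ℕ → ℝ} (h : PB a) {x : ℝ} (hx : |x| < 1) :
    HasDerivAt (PS a) (PS (DC a) x) x := by
  obtain ⟨r, hr1, hr2⟩ := exists_between hx
  have hr0 : 0 < r := (abs_nonneg x).trans_lt hr1
  have key : HasDerivAt (fun z => ∑' n, a n * z^n) (∑' n : ℕ, a n * ((n:ℝ) * x^(n-1))) x := by
    have hs : Summable (fun n : ℕ => |a n| * ((n:ℝ) * r^(n-1))) := by
      rw [← summable_nat_add_iff 1]
      have := (h.dc.summable (x := r) (by rwa [abs_of_pos hr0])).abs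
      refine this.congr ?_
      intro n
      simp only [DC, abs_mul, abs_pow, abs_of_pos hr0]
      rw [abs_of_nonneg (by positivity : (0:ℝ) ≤ (n:ℝ)+1)]
      push_cast
      ring
    refine hasDerivAt_tsum_of_isPreconnected (g := fun n z => a n * z^n)
      (g' := fun n z => a n * ((n:ℝ) * z^(n-1))) (t := Metric.ball 0 r) (y₀ := x) hs Metric.isOpen_ball
      (convex_ball (0:ℝ) r).isPreconnected ?_ ?_ ?_ (h.summable hx) ?_
    · intro n y hy
      exact (hasDerivAt_pow n y).const_mul (a n)
    · intro n y hy
      show ‖a n * ((n:ℝ) * y^(n-1))‖ ≤ _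
      have : |y| < r := by simpa using hy
      rw [Real.norm_eq_abs, abs_mul, abs_mul, abs_pow, Nat.abs_cast]
      gcongr
    · simpa using hr1
    · simpa using hr1
  have e : (∑' n : ℕ, a n * ((n:ℝ) * x^(n-1))) = PS (DC a) x := by
    have hs : HasSum (fun n : ℕ => a n * ((n:ℝ) * x^(n-1))) (PS (DC a) x) := by
      rw [← hasSum_nat_add_iff' 1]
      simp only [Finset.sum_range_one, Nat.cast_zero, zero_mul, mul_zero, sub_zero]
      refine (h.dc.hasSum hx).congr_fun ?_
      intro n
      simp only [DC]; push_cast; ring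
    exact hs.tsum_eq
  rw [e] at key
  exact key

theorem abel_lim {a : ℕ → ℝ} (h : PB a) {L : ℝ} (hL : Tendsto a atTop (𝓝 L)) :
    Tendsto (fun y => (1-y) * PS a y) (𝓝[<] 1) (𝓝 L) := by
  let b : ℕ → ℝ := fun n => a n - (if n = 0 then 0 else a (n-1))
  have hb : ∀ n, ∑ i ∈ Finset.range (n+1), b i = a n := by
    intro n
    induction n with
    | zero => simp [b]
    | succ n ih => rw [Finset.sum_range_succ, ih]; simp [b]
  have hb2 : Tendsto (fun n => ∑ i ∈ Finset.range n, b i) atTop (𝓝 L) := by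
    rw [← tendsto_add_atTop_iff_nat 1]
    simpa only [hb] using hL
  have := Real.tendsto_tsum_powerSeries_nhdsWithin_lt hb2
  refine this.congr' ?_
  have : Set.Ioo (0:ℝ) 1 ∈ 𝓝[<] (1:ℝ) := Ioo_mem_nhdsLT (by norm_num)
  filter_upwards [this] with y hy
  have hy' : |y| < 1 := by rw [abs_of_pos hy.1]; exact hy.2
  have h1 := h.hasSum hy'
  have h2 : HasSum (fun n => (if n = 0 then 0 else a (n-1)) * y^n) (y * PS a y) := by
    rw [← hasSum_nat_add_iff' 1]
    simp only [Finset.sum_range_one, if_true, zero_mul, sub_zero]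
    refine (h1.mul_left y).congr_fun ?_
    intro n; simp; ring
  have h3 := (h1.sub h2).congr_fun (g := fun n => b n * y^n) (by intro n; simp only [b]; ring)
  rw [h3.tsum_eq]; ring

theorem hg_ode {h : ℕ → ℝ} (hb : PB h) (a c : ℝ)
    (hr : ∀ n : ℕ, ((n:ℝ)+1) * (n + c) * h (n+1) = (n + a)^2 * h n) {y : ℝ} (hy : |y| < 1) :
    y * (1-y) * PS (DC (DC h)) y + (c - (2*a+1)*y) * PS (DC h) y - a^2 * PS h y = 0 := by
  have h0 := hb.hasSum hy
  have h1 := hb.dc.hasSum hy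
  have t0 := hb.theta hy
  have t1 := hb.dc.theta hy
  have hb2 : PB (fun n : ℕ => (n:ℝ) * h n) := by
    obtain ⟨C, k, hC, hb⟩ := hb
    refine ⟨C, k+1, hC, fun n => ?_⟩
    rw [abs_mul, Nat.abs_cast, pow_succ]
    have := hb n
    calc (n:ℝ) * |h n| ≤ ((n:ℝ)+1) * (C * ((n:ℝ)+1)^k) := by gcongr; linarith
      _ = _ := by ring
  have t2 := hb2.theta hy
  have e : PS (DC (fun n : ℕ => (n:ℝ) * h n)) y = y * PS (DC (DC h)) y + PS (DC h) y := by
    refine (hb2.dc.hasSum hy).unique ((t1.add h1).congr_fun ?_)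
    intro n; simp only [DC]; push_cast; ring
  rw [e] at t2
  have tot := ((t1.add (h1.mul_left c)).sub ((t2.add (t0.mul_left (2*a))).add (h0.mul_left (a^2))))
  have z : HasSum (fun _ : ℕ => (0:ℝ)) _ := tot.congr_fun (by
    intro n
    have := hr n
    simp only [DC]
    linear_combination (-(y^n)) * this)
  have := z.unique hasSum_zero
  linear_combination this

theorem s_ode {h : ℕ → ℝ} (hb : PB h)
    (hr : ∀ n : ℕ, ((n:ℝ)+1)^3 * h (n+1) = (n + 1/2) * (n+1/3) * (n+2/3) * h n) {y : ℝ} (hy : |y| < 1) :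
    (1-y) * (y^2 * PS (DC (DC (DC h))) y + 3 * y * PS (DC (DC h)) y + PS (DC h) y)
      = 3/2 * (y^2 * PS (DC (DC h)) y + y * PS (DC h) y) + 13/18 * y * PS (DC h) y
        + 1/9 * PS h y := by
  have hth : ∀ g : ℕ → ℝ, PB g → PB (fun n : ℕ => (n:ℝ) * g n) := by
    intro g hb
    obtain ⟨C, k, hC, hb⟩ := hb
    refine ⟨C, k+1, hC, fun n => ?_⟩
    rw [abs_mul, Nat.abs_cast, pow_succ]
    have := hb n
    calc (n:ℝ) * |g n| ≤ ((n:ℝ)+1) * (C * ((n:ℝ)+1)^k) := by gcongr; linarith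
      _ = _ := by ring
  have e : ∀ g : ℕ → ℝ, PB g → PS (DC (fun n : ℕ => (n:ℝ) * g n)) y
      = y * PS (DC (DC g)) y + PS (DC g) y := by
    intro g hg
    refine ((hth g hg).dc.hasSum hy).unique (((hg.dc.theta hy).add (hg.dc.hasSum hy)).congr_fun ?_)
    intro n; simp only [DC]; push_cast; ring
  have h0 := hb.hasSum hy
  have t1 := hb.theta hy
  have t2 := (hth _ hb).theta hy
  have t3 := (hth _ (hth _ hb)).theta hy
  have d1 := hb.dc.hasSum hy
  have d2 := hb.dc.theta hy
  have d3 := (hth _ hb.dc).theta hy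
  have e2 : PS (DC (fun n : ℕ => (n:ℝ) * ((n:ℝ) * h n))) y
      = y * (y * PS (DC (DC (DC h))) y + 2 * PS (DC (DC h)) y) + (y * PS (DC (DC h)) y + PS (DC h) y) := by
    refine ((hth _ (hth _ hb)).dc.hasSum hy).unique ?_
    have q := ((d3.add (d2.mul_left 2)).add d1)
    rw [e _ hb.dc] at q
    have q2 := q.congr_fun (g := fun n => DC (fun n : ℕ => (n:ℝ) * ((n:ℝ) * h n)) n * y^n) (by
      intro n; simp only [DC]; push_cast; ring)
    convert q2 using 1
    ring
  rw [e2] at t3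
  rw [e _ hb] at t2
  rw [e _ hb.dc] at d3
  have tot := ((d3.add (d2.mul_left 2)).add d1).sub
    (((t3.add (t2.mul_left (3/2))).add (t1.mul_left (13/18))).add (h0.mul_left (1/9)))
  have z : HasSum (fun _ : ℕ => (0:ℝ)) _ := tot.congr_fun (by
    intro n
    have := hr n
    simp only [DC]
    linear_combination (-(y^n)) * this)
  have := z.unique hasSum_zero
  linear_combination this

/-- the coefficients of the Ramanujan series -/
noncomputable def tc (n : ℕ) : ℝ := (poch (1/2) n * poch (1/3) n * poch (2/3) n) / (poch 1 n)^3

/-- coefficients of a Gauss series -/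
noncomputable def hg (a c : ℝ) (n : ℕ) : ℝ := poch a n ^ 2 / (poch 1 n * poch c n)

theorem tc_rec (n : ℕ) : ((n:ℝ)+1)^3 * tc (n+1) = (n + 1/2) * (n+1/3) * (n+2/3) * tc n := by
  have h1 := (poch_pos 1 one_pos n).ne'
  have h2 : (1 + (n:ℝ)) ≠ 0 := by positivity
  simp only [tc, poch_succ]
  field_simp
  ring

theorem hg_rec (a c : ℝ) (hc : 0 < c) (n : ℕ) :
    ((n:ℝ)+1) * (n + c) * hg a c (n+1) = (n + a)^2 * hg a c n := by
  have h1 := (poch_pos 1 one_pos n).ne'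
  have h3 := (poch_pos c hc n).ne'
  have h2 : (1 + (n:ℝ)) ≠ 0 := by positivity
  have h4 : (c + (n:ℝ)) ≠ 0 := by positivity
  simp only [hg, poch_succ]
  field_simp
  ring

theorem tc_pos (n : ℕ) : 0 < tc n := by
  have h1 := poch_pos 1 one_pos n
  have h2 := poch_pos (1/2) (by norm_num) n
  have h3 := poch_pos (1/3) (by norm_num) n
  have h4 := poch_pos (2/3) (by norm_num) n
  unfold tc; positivity

theorem tc_zero : tc 0 = 1 := by simp [tc, poch_zero]
theorem hg_zero (a c : ℝ) : hg a c 0 = 1 := by simp [hg, poch_zero]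

theorem tc_one : tc 1 = 1/9 := by
  have := tc_rec 0
  rw [tc_zero] at this; norm_num at this; rw [this]

theorem tc_le (n : ℕ) : tc (n+1) ≤ 1/9 := by
  induction n with
  | zero => exact tc_one.le
  | succ n ih =>
    refine le_trans ?_ ih
    have h := tc_rec (n+1)
    have hp := tc_pos (n+1)
    have hn : (0:ℝ) ≤ ((n+1:ℕ):ℝ) := Nat.cast_nonneg _
    generalize ((n+1:ℕ):ℝ) = m at *
    have : (m+1)^3 * tc (n+1+1) ≤ (m+1)^3 * tc (n+1) := by
      rw [h]
      apply mul_le_mul_of_nonneg_right _ hp.le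
      nlinarith [mul_nonneg hn hn, mul_nonneg hn (mul_nonneg hn hn)]
    exact le_of_mul_le_mul_left this (by positivity)

theorem tc_PB : PB tc := by
  refine ⟨1, 0, zero_le_one, fun n => ?_⟩
  rw [abs_of_pos (tc_pos n)]
  rcases n with _ | n
  · simp [tc_zero]
  · have := tc_le n
    simp only [pow_zero]; linarith

theorem hg_pos (a c : ℝ) (ha : 0 < a) (hc : 0 < c) (n : ℕ) : 0 < hg a c n := by
  have h1 := poch_pos 1 one_pos n
  have h2 := poch_pos a ha n
  have h3 := poch_pos c hc n
  unfold hg; positivity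

theorem hg_PB (a c : ℝ) (ha : 0 < a) (ha1 : a < 1) (hc : c = 2*a) : PB (hg a c) := by
  refine ⟨1, 0, zero_le_one, fun n => ?_⟩
  have hc0 : 0 < c := by linarith
  rw [abs_of_pos (hg_pos a c ha hc0 n)]
  simp only [pow_zero, mul_one]
  induction n with
  | zero => exact (hg_zero a c).le
  | succ n ih =>
    refine le_trans ?_ ih
    have h := hg_rec a c hc0 n
    have hp := hg_pos a c ha hc0 n
    have hn : (0:ℝ) ≤ (n:ℝ) := Nat.cast_nonneg _
    have : ((n:ℝ)+1) * (n+c) * hg a c (n+1) ≤ ((n:ℝ)+1) * (n+c) * hg a c n := by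
      rw [h]
      apply mul_le_mul_of_nonneg_right _ hp.le
      subst hc
      nlinarith
    exact le_of_mul_le_mul_left this (by positivity)

theorem poch_gs (s : ℝ) (hs : 0 < s) (n : ℕ) :
    Real.GammaSeq s n * poch s (n+1) = (n:ℝ)^s * poch 1 n ∧ poch s (n+1) = ∏ j ∈ Finset.range (n + 1), (s + j) := by
  have e : ∀ n, poch s n = ∏ j ∈ Finset.range n, (s + j) := by
    intro n
    induction n with
    | zero => simp [poch_zero]
    | succ n ih => rw [poch_succ, ih, Finset.prod_range_succ]
  have f : poch 1 n = (n.factorial : ℝ) := by rw [poch, ascPochhammer_eval_one]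
  refine ⟨?_, e _⟩
  have := (poch_pos s hs (n+1)).ne'
  rw [Real.GammaSeq, ← e, f]
  field_simp

theorem hg_lim (a c : ℝ) (ha : 0 < a) (hc : c = 2*a) :
    Tendsto (DC (hg a c)) atTop (𝓝 (Real.Gamma c / Real.Gamma a ^ 2)) := by
  have hc0 : 0 < c := by linarith
  have h1 := (Real.GammaSeq_tendsto_Gamma c).div ((Real.GammaSeq_tendsto_Gamma a).pow 2)
    (pow_ne_zero 2 (Real.Gamma_pos_of_pos ha).ne')
  refine h1.congr' ?_
  filter_upwards [eventually_gt_atTop 0] with n hn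
  have hn' : (0:ℝ) < n := by exact_mod_cast hn
  have p1 := (poch_gs a ha n).1
  have p2 := (poch_gs c hc0 n).1
  have q1 := (poch_pos a ha (n+1)).ne'
  have q2 := (poch_pos c hc0 (n+1)).ne'
  have q3 := (poch_pos 1 one_pos n).ne'
  have q4 : ((n:ℝ)^a) ≠ 0 := (Real.rpow_pos_of_pos hn' a).ne'
  have e : (n:ℝ)^c = ((n:ℝ)^a)^2 := by
    rw [hc, two_mul, Real.rpow_add hn', sq]
  rw [e] at p2
  have r1 : Real.GammaSeq a n = (n:ℝ)^a * poch 1 n / poch a (n+1) := by field_simp; exact p1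
  have r2 : Real.GammaSeq c n = ((n:ℝ)^a)^2 * poch 1 n / poch c (n+1) := by field_simp; exact p2
  show Real.GammaSeq c n / Real.GammaSeq a n ^ 2 = _
  rw [r1, r2, DC, hg, poch_succ 1]
  have q5 : (1 + (n:ℝ)) ≠ 0 := by positivity
  field_simp
  ring

theorem gamma_prod : (Real.Gamma (2/3) / Real.Gamma (1/3)^2) * (Real.Gamma (4/3) / Real.Gamma (2/3)^2)
    = Real.sqrt 3 / (6 * π) := by
  have h1 := (Real.Gamma_pos_of_pos (show (0:ℝ) < 1/3 by norm_num)).ne'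
  have h2 := (Real.Gamma_pos_of_pos (show (0:ℝ) < 2/3 by norm_num)).ne'
  have h3 : Real.Gamma (4/3) = 1/3 * Real.Gamma (1/3) := by
    rw [← Real.Gamma_add_one (by norm_num)]; norm_num
  have h4 := Real.Gamma_mul_Gamma_one_sub (1/3)
  have h5 : π * (1/3) = π/3 := by ring
  rw [h5, Real.sin_pi_div_three, show (1:ℝ) - 1/3 = 2/3 by norm_num] at h4
  have h6 : Real.sqrt 3 ≠ 0 := by positivity
  have h8 : Real.sqrt 3 * Real.Gamma (1/3) * Real.Gamma (2/3) = 2 * π := by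
    rw [mul_assoc, h4]; field_simp
  have hpi := Real.pi_ne_zero
  rw [h3]
  field_simp
  linear_combination (-3) * h8

theorem first_int {z : ℝ} (hz : z < 0) (hz1 : -1 < z) :
    (1-z) * (2 * PS tc z * (PS (DC tc) z + z * PS (DC (DC tc)) z) - z * (PS (DC tc) z)^2)
      - z * PS tc z * PS (DC tc) z - 2/9 * (PS tc z)^2 = 0 := by
  let I : ℝ → ℝ := fun z => z * ((1-z) * (2 * PS tc z * (PS (DC tc) z + z * PS (DC (DC tc)) z)
    - z * (PS (DC tc) z)^2) - z * PS tc z * PS (DC tc) z - 2/9 * (PS tc z)^2)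
  have hI : ∀ y : ℝ, |y| < 1 → HasDerivAt I 0 y := by
    intro y hy
    have h0 := tc_PB.hasDerivAt hy
    have h1 := tc_PB.dc.hasDerivAt hy
    have h2 := tc_PB.dc.dc.hasDerivAt hy
    have hid := hasDerivAt_id' y
    have ode := s_ode tc_PB tc_rec hy
    have hd := hid.mul ((((((hasDerivAt_const y (1:ℝ)).sub hid)).mul (((h0.const_mul 2).mul (h1.add (hid.mul h2))).sub
      (hid.mul (h1.pow 2)))).sub ((hid.mul h0).mul h1)).sub ((h0.pow 2).const_mul (2/9)))
    refine HasDerivAt.congr_deriv hd ?_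
    simp
    linear_combination (2 * PS tc y) * ode
  have hc : ∀ y ∈ Set.Icc z 0, I y = I z := by
    apply constant_of_has_deriv_right_zero
    · intro y hy
      exact (hI y (by rw [abs_lt]; constructor <;> linarith [hy.1, hy.2])).continuousAt.continuousWithinAt
    · intro y hy
      exact (hI y (by rw [abs_lt]; constructor <;> linarith [hy.1, hy.2])).hasDerivWithinAt
  have h := hc 0 ⟨hz.le, le_refl _⟩
  have h0 : I 0 = 0 := by simp [I]
  rw [h0] at h
  exact (mul_eq_zero.1 h.symm).resolve_left hz.ne

theorem S_pos {z : ℝ} (hz : |z| ≤ 9/16) : 0 < PS tc z := by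
  have hz1 : |z| < 1 := by linarith
  have h := tc_PB.hasSum hz1
  rw [← hasSum_nat_add_iff' 1] at h
  simp only [Finset.sum_range_one, pow_zero, mul_one, tc_zero] at h
  have hg := (hasSum_geometric_of_lt_one (abs_nonneg z) hz1).mul_left (1/9 * |z|)
  have := hasSum_le (f := fun n => -(tc (n+1) * z^(n+1))) (fun n => ?_) h.neg hg
  · have : 1/9 * |z| * (1 - |z|)⁻¹ ≤ 1/7 := by
      rw [← div_eq_mul_inv, div_le_iff₀ (by linarith)]; linarith
    linarith
  · refine (neg_le_abs _).trans ?_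
    rw [abs_mul, abs_of_pos (tc_pos _), abs_pow, pow_succ]
    have := tc_le n
    have hp : 0 ≤ |z|^n * |z| := by positivity
    nlinarith

/-- square root of the series as a function of x -/
noncomputable def rr (x : ℝ) : ℝ := Real.sqrt (PS tc (4*x*(1-x)))
/-- derivative of rr -/
noncomputable def rd (x : ℝ) : ℝ := (4-8*x) * PS (DC tc) (4*x*(1-x)) / (2 * rr x)

theorem zb {x : ℝ} (h1 : -1/8 ≤ x) (h2 : x ≤ 0) : |4*x*(1-x)| ≤ 9/16 := by
  rw [abs_le]; constructor <;> nlinarith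

theorem z_deriv (x : ℝ) : HasDerivAt (fun x : ℝ => 4*x*(1-x)) (4-8*x) x := by
  have hid := hasDerivAt_id' x
  refine ((hid.const_mul 4).mul ((hasDerivAt_const x (1:ℝ)).sub hid)).congr_deriv ?_
  simp; ring

theorem rr_pos {x : ℝ} (h1 : -1/8 ≤ x) (h2 : x ≤ 0) : 0 < rr x :=
  Real.sqrt_pos.2 (S_pos (zb h1 h2))

theorem rr_deriv {x : ℝ} (h1 : -1/8 ≤ x) (h2 : x ≤ 0) : HasDerivAt rr (rd x) x := by
  have hz := zb h1 h2
  have hd := (tc_PB.hasDerivAt (by linarith : |4*x*(1-x)| < 1)).comp x (z_deriv x)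
  refine (hd.sqrt (S_pos hz).ne').congr_deriv ?_
  simp only [rd, rr, Function.comp]
  ring

theorem prd_deriv {x : ℝ} (h1 : -1/8 ≤ x) (h2 : x < 0) :
    HasDerivAt (fun x => x*(1-x) * rd x) (2/9 * rr x) x := by
  have hz := zb h1 h2.le
  have hz1 : |4*x*(1-x)| < 1 := by linarith
  have hq := (tc_PB.dc.hasDerivAt hz1).comp x (z_deriv x)
  have hr := rr_deriv h1 h2.le
  have hid := hasDerivAt_id' x
  have hrp := rr_pos h1 h2.le
  have hlin : HasDerivAt (fun x : ℝ => 4-8*x) (-8) x := by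
    refine ((hasDerivAt_const x (4:ℝ)).sub (hid.const_mul 8)).congr_deriv ?_
    simp
  have hrd := (hlin.mul hq).div (hr.const_mul 2) (by positivity)
  have hp := (hid.mul ((hasDerivAt_const x (1:ℝ)).sub hid)).mul hrd
  refine HasDerivAt.congr_deriv hp ?_
  have fi := first_int (z := 4*x*(1-x)) (by nlinarith) (by nlinarith [abs_lt.1 hz1])
  have hS : PS tc (4*x*(1-x)) = (rr x)^2 := by
    rw [rr, Real.sq_sqrt (S_pos hz).le]
  rw [hS] at fi
  simp only [rd, Function.comp, Pi.mul_apply, Pi.sub_apply, Pi.div_apply]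
  generalize rr x = r at *
  generalize PS (DC tc) (4*x*(1-x)) = q at *
  generalize PS (DC (DC tc)) (4*x*(1-x)) = s at *
  have hrne := hrp.ne'
  field_simp
  linear_combination 36 * fi

/-- cubic change of variable -/
noncomputable def xs (s : ℝ) : ℝ := ((s-1)/(s+2))^3
/-- its derivative -/
noncomputable def xd (s : ℝ) : ℝ := 9*(s-1)^2/(s+2)^4
/-- the main solution of the transformed equation -/
noncomputable def ph (s : ℝ) : ℝ := 3 * rr (xs s) / (s+2)
/-- derivative of ph -/
noncomputable def ph1 (s : ℝ) : ℝ := 3 * rd (xs s) * xd s / (s+2) - 3 * rr (xs s) / (s+2)^2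

theorem xs_deriv {s : ℝ} (h : 0 ≤ s) : HasDerivAt xs (xd s) s := by
  have hid := hasDerivAt_id' s
  have hne : s + 2 ≠ 0 := by positivity
  refine (((hid.sub_const 1).div (hid.add_const 2) hne).pow 3).congr_deriv ?_
  simp [xd]
  field_simp
  ring

theorem xs_bd {s : ℝ} (h0 : 0 ≤ s) (h1 : s ≤ 1) : -1/8 ≤ xs s ∧ xs s ≤ 0 := by
  have a : -1/2 ≤ (s-1)/(s+2) := by rw [le_div_iff₀ (by linarith)]; linarith
  have b : (s-1)/(s+2) ≤ 0 := div_nonpos_of_nonpos_of_nonneg (by linarith) (by linarith)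
  rw [xs]
  generalize (s-1)/(s+2) = w at *
  constructor
  · nlinarith [mul_nonneg (sub_nonneg.2 a) (sub_nonneg.2 b), sq_nonneg (w-1/2), sq_nonneg w, sq_nonneg (w-1)]
  · have : 0 ≤ (-w)^3 := by apply pow_nonneg; linarith
    nlinarith

theorem xs_neg {s : ℝ} (h0 : 0 ≤ s) (h1 : s < 1) : xs s < 0 := by
  have b : (s-1)/(s+2) < 0 := div_neg_of_neg_of_pos (by linarith) (by linarith)
  rw [xs]
  exact Odd.pow_neg (by decide) b

theorem ph_deriv {s : ℝ} (h0 : 0 ≤ s) (h1 : s ≤ 1) : HasDerivAt ph (ph1 s) s := by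
  have hid := hasDerivAt_id' s
  have hne : s + 2 ≠ 0 := by positivity
  have hx := xs_bd h0 h1
  have hr := (rr_deriv hx.1 hx.2).comp s (xs_deriv h0)
  refine ((hr.const_mul 3).div (hid.add_const 2) hne).congr_deriv ?_
  simp only [ph1, Function.comp]
  field_simp

theorem psi_deriv {s : ℝ} (h0 : 0 ≤ s) (h1 : s < 1) :
    HasDerivAt (fun s => (1-s^3) * ph1 s) (s * ph s) s := by
  have hid := hasDerivAt_id' s
  have hne : s + 2 ≠ 0 := by positivity
  have hx := xs_bd h0 h1.le
  have hr := (rr_deriv hx.1 hx.2).comp s (xs_deriv h0)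
  have hp := (prd_deriv hx.1 (xs_neg h0 h1)).comp s (xs_deriv h0)
  have hc : HasDerivAt (fun s : ℝ => 1 - s^3) (-(3*s^2)) s := by
    refine ((hasDerivAt_const s (1:ℝ)).sub (hid.pow 3)).congr_deriv ?_
    simp
  have hd := ((((hid.add_const 2).mul hp).const_mul (-3)).sub
    (((hc.mul hr).const_mul 3).div ((hid.add_const 2).pow 2) (by
      show (s+2)^2 ≠ 0
      positivity)))
  refine (hd.congr_of_eventuallyEq (f₁ := fun s => (1-s^3) * ph1 s) ?_).congr_deriv ?_
  · filter_upwards [eventually_gt_nhds (show (-2:ℝ) < s by linarith)] with y hy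
    have hyn : y + 2 ≠ 0 := by linarith
    simp only [Function.comp, Pi.mul_apply, Pi.sub_apply, Pi.div_apply, Pi.pow_apply, ph1, xd, xs]
    generalize rr (((y-1)/(y+2))^3) = r at *
    generalize rd (((y-1)/(y+2))^3) = q at *
    field_simp
    ring
  · simp only [Function.comp, Pi.mul_apply, Pi.pow_apply, ph, xd, xs]
    generalize rr (((s-1)/(s+2))^3) = r at *
    generalize rd (((s-1)/(s+2))^3) = q at *
    field_simp
    norm_num
    ring

theorem wron (g g1 : ℝ → ℝ) (L : ℝ) (hg : ∀ s, 0 ≤ s → s < 1 → HasDerivAt g (g1 s) s)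
    (hg1 : ∀ s, 0 ≤ s → s < 1 → HasDerivAt (fun s => (1-s^3) * g1 s) (s * g s) s)
    (hl : Tendsto (fun s => (1-s^3) * g1 s) (𝓝[<] 1) (𝓝 L))
    (hl0 : Tendsto (fun s => (1-s^3) * g s) (𝓝[<] 1) (𝓝 0)) :
    ph 0 * g1 0 - ph1 0 * g 0 = L := by
  let K : ℝ → ℝ := fun s => ph s * ((1-s^3) * g1 s) - ((1-s^3) * ph1 s) * g s
  have hK : ∀ s, 0 ≤ s → s < 1 → HasDerivAt K 0 s := by
    intro s h0 h1
    have := ((ph_deriv h0 h1.le).mul (hg1 s h0 h1)).sub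
      ((psi_deriv h0 h1).mul (hg s h0 h1))
    refine HasDerivAt.congr_deriv this ?_
    ring
  have hrdc : ContinuousAt ph1 1 := by
    have hx := xs_bd (zero_le_one) (le_refl (1:ℝ))
    have hz := zb hx.1 hx.2
    have hxc := (xs_deriv (zero_le_one)).continuousAt
    have hrc : ContinuousAt (fun s => rr (xs s)) 1 :=
      ContinuousAt.comp (f := xs) (g := rr) (rr_deriv hx.1 hx.2).continuousAt hxc
    have hq : ContinuousAt (fun s => PS (DC tc) (4*xs s*(1-xs s))) 1 :=
      ContinuousAt.comp (f := fun s => 4*xs s*(1-xs s)) (g := PS (DC tc))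
        (tc_PB.dc.hasDerivAt (by linarith)).continuousAt
        ((hxc.const_mul 4).mul (continuousAt_const.sub hxc))
    have hrp := rr_pos hx.1 hx.2
    have hrd : ContinuousAt (fun s => rd (xs s)) 1 := by
      unfold rd
      exact ((continuousAt_const.sub (hxc.const_mul 8)).mul hq).div (hrc.const_mul 2) (by positivity)
    have hxd : ContinuousAt xd 1 := by
      unfold xd
      refine ContinuousAt.div (by fun_prop) (by fun_prop) (by norm_num)
    unfold ph1
    refine ContinuousAt.sub (ContinuousAt.div ((hrd.const_mul 3).mul hxd) (by fun_prop) (by norm_num))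
      (ContinuousAt.div (hrc.const_mul 3) (by fun_prop) (by norm_num))
  have hK0 : ∀ s, 0 ≤ s → s < 1 → K s = K 0 := by
    intro s h0 h1
    refine constant_of_has_deriv_right_zero (a := 0) (b := s) ?_ ?_ s ⟨h0, le_refl _⟩
    · intro y hy
      have hy1 : y < 1 := lt_of_le_of_lt hy.2 h1
      exact (hK y hy.1 hy1).continuousAt.continuousWithinAt
    · intro y hy
      exact (hK y hy.1 (hy.2.trans h1)).hasDerivWithinAt
  have e0 : K 0 = ph 0 * g1 0 - ph1 0 * g 0 := by simp [K]
  rw [← e0]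
  have hph1 : ph 1 = 1 := by
    simp [ph, xs, rr, PS_zero, tc_zero]; norm_num
  have hlim : Tendsto K (𝓝[<] 1) (𝓝 (1 * L - ph1 1 * 0)) := by
    have h1 : Tendsto ph (𝓝[<] 1) (𝓝 1) := by
      have := (ph_deriv zero_le_one le_rfl).continuousAt.tendsto
      rw [hph1] at this
      exact this.mono_left nhdsWithin_le_nhds
    have h2 : Tendsto ph1 (𝓝[<] 1) (𝓝 (ph1 1)) := hrdc.tendsto.mono_left nhdsWithin_le_nhds
    refine ((h1.mul hl).sub (h2.mul hl0)).congr ?_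
    intro s; simp only [K]; ring
  have hlim2 : Tendsto K (𝓝[<] 1) (𝓝 (K 0)) := by
    refine tendsto_const_nhds.congr' ?_
    have : Set.Ioo (0:ℝ) 1 ∈ 𝓝[<] (1:ℝ) := Ioo_mem_nhdsLT (by norm_num)
    filter_upwards [this] with y hy
    exact (hK0 y hy.1.le hy.2).symm
  have := tendsto_nhds_unique hlim hlim2
  linarith

theorem cube_tendsto : Tendsto (fun s : ℝ => s^3) (𝓝[<] 1) (𝓝[<] 1) := by
  rw [tendsto_nhdsWithin_iff]
  constructor
  · have : ContinuousAt (fun s : ℝ => s^3) 1 := by fun_prop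
    have h := this.tendsto
    simp only [one_pow] at h
    exact h.mono_left nhdsWithin_le_nhds
  · have : Set.Ioo (0:ℝ) 1 ∈ 𝓝[<] (1:ℝ) := Ioo_mem_nhdsLT (by norm_num)
    filter_upwards [this] with y hy
    exact pow_lt_one₀ hy.1.le hy.2 (by norm_num)

theorem cube_abs {s : ℝ} (h0 : 0 ≤ s) (h1 : s < 1) : |s^3| < 1 := by
  rw [abs_of_nonneg (by positivity)]
  exact pow_lt_one₀ h0 h1 (by norm_num)

theorem cube_deriv (s : ℝ) : HasDerivAt (fun s : ℝ => s^3) (3*s^2) s := by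
  simpa using hasDerivAt_pow 3 s

theorem PB.cube {a : ℕ → ℝ} (h : PB a) {s : ℝ} (h0 : 0 ≤ s) (h1 : s < 1) :
    HasDerivAt (fun s => PS a (s^3)) (PS (DC a) (s^3) * (3*s^2)) s :=
  HasDerivAt.comp (h₂ := PS a) (h := fun s : ℝ => s^3) s (h.hasDerivAt (cube_abs h0 h1)) (cube_deriv s)

theorem lims (a c : ℝ) (ha : 0 < a) (ha1 : a < 1) (hc : c = 2*a) :
    Tendsto (fun s : ℝ => (1-s^3) * PS (DC (hg a c)) (s^3)) (𝓝[<] 1) (𝓝 (Real.Gamma c / Real.Gamma a ^ 2))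
    ∧ Tendsto (fun s : ℝ => (1-s^3) * PS (hg a c) (s^3)) (𝓝[<] 1) (𝓝 0) := by
  have hb := hg_PB a c ha ha1 hc
  have hl := hg_lim a c ha hc
  have h0 : Tendsto (hg a c) atTop (𝓝 0) := by
    rw [← tendsto_add_atTop_iff_nat 1]
    have := hl.mul (tendsto_one_div_add_atTop_nhds_zero_nat (𝕜 := ℝ))
    rw [mul_zero] at this
    refine this.congr ?_
    intro n
    have : (n:ℝ)+1 ≠ 0 := by positivity
    simp only [DC]; field_simp
  exact ⟨(abel_lim hb.dc hl).comp cube_tendsto, (abel_lim hb h0).comp cube_tendsto⟩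

theorem sq_tendsto (k : ℕ) : Tendsto (fun s : ℝ => 3 * s^k) (𝓝[<] 1) (𝓝 3) := by
  have : ContinuousAt (fun s : ℝ => 3 * s^k) 1 := by fun_prop
  have h := this.tendsto
  simp only [one_pow, mul_one] at h
  exact h.mono_left nhdsWithin_le_nhds

theorem valB : - ph1 0 = 3 * (Real.Gamma (2/3) / Real.Gamma (1/3) ^ 2) := by
  have hb := hg_PB (1/3) (2/3) (by norm_num) (by norm_num) (by norm_num)
  have hl := lims (1/3) (2/3) (by norm_num) (by norm_num) (by norm_num)
  have := wron (fun s => PS (hg (1/3) (2/3)) (s^3))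
    (fun s => PS (DC (hg (1/3) (2/3))) (s^3) * (3*s^2)) _ ?_ ?_
    (((sq_tendsto 2).mul hl.1).congr (by intro s; ring)) hl.2
  · rw [← this]; simp [PS_zero, hg_zero]
  · intro s h0 h1
    exact hb.cube h0 h1
  · intro s h0 h1
    have hd := hb.dc.cube h0 h1
    have ode := hg_ode hb (1/3) (2/3) (hg_rec _ _ (by norm_num)) (cube_abs h0 h1)
    have h2 : HasDerivAt (fun s : ℝ => 3*s^2) (6*s) s := by
      refine ((hasDerivAt_pow 2 s).const_mul 3).congr_deriv ?_
      norm_num; ring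
    have h3 : HasDerivAt (fun s : ℝ => 1-s^3) (-(3*s^2)) s := (cube_deriv s).const_sub 1
    refine (h3.mul (hd.mul h2)).congr_deriv ?_
    simp only [Pi.mul_apply]
    linear_combination (9*s) * ode

theorem valA : ph 0 = 3 * (Real.Gamma (4/3) / Real.Gamma (2/3) ^ 2) := by
  have hb := hg_PB (2/3) (4/3) (by norm_num) (by norm_num) (by norm_num)
  have hl := lims (2/3) (4/3) (by norm_num) (by norm_num) (by norm_num)
  have hlim := ((sq_tendsto 3).mul hl.1).add hl.2
  rw [add_zero] at hlim
  have hid1 : Tendsto (fun s : ℝ => s) (𝓝[<] 1) (𝓝 1) := tendsto_id.mono_left nhdsWithin_le_nhds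
  have hl0 := hid1.mul hl.2
  rw [mul_zero] at hl0
  have := wron (fun s => s * PS (hg (2/3) (4/3)) (s^3))
    (fun s => PS (hg (2/3) (4/3)) (s^3) + s * (PS (DC (hg (2/3) (4/3))) (s^3) * (3*s^2))) _ ?_ ?_
    (hlim.congr (by intro s; ring)) (hl0.congr (by intro s; ring))
  · rw [← this]; simp [PS_zero, hg_zero]
  · intro s h0 h1
    have hd := hb.cube h0 h1
    refine ((hasDerivAt_id' s).mul hd).congr_deriv ?_
    ring
  · intro s h0 h1
    have hd0 := hb.cube h0 h1
    have hd := hb.dc.cube h0 h1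
    have ode := hg_ode hb (2/3) (4/3) (hg_rec _ _ (by norm_num)) (cube_abs h0 h1)
    have h2 : HasDerivAt (fun s : ℝ => 3*s^2) (6*s) s := by
      refine ((hasDerivAt_pow 2 s).const_mul 3).congr_deriv ?_
      norm_num; ring
    have h3 : HasDerivAt (fun s : ℝ => 1-s^3) (-(3*s^2)) s := (cube_deriv s).const_sub 1
    refine (h3.mul (hd0.add ((hasDerivAt_id' s).mul (hd.mul h2)))).congr_deriv ?_
    simp only [Pi.mul_apply, Pi.add_apply]
    linear_combination (9*s^2) * ode

theorem stmt_4 :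
    ∑' n : ℕ, (poch (1/2) n * poch (1/3) n * poch (2/3) n) / (poch 1 n)^3 * (5*(n:ℝ)+1) * ((-9:ℝ)/16)^n = 4 * Real.sqrt 3 / (3*π) := by
  have hz : |(-9:ℝ)/16| < 1 := by rw [abs_lt]; constructor <;> norm_num
  have h1 := ((tc_PB.theta hz).mul_left 5).add (tc_PB.hasSum hz)
  have h2 : HasSum (fun n : ℕ => (poch (1/2) n * poch (1/3) n * poch (2/3) n) / (poch 1 n)^3 * (5*(n:ℝ)+1) * ((-9:ℝ)/16)^n) _ :=
    h1.congr_fun (by intro n; simp only [tc]; ring)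
  rw [h2.tsum_eq]
  have hA := valA
  have hB := valB
  have hg := gamma_prod
  have hprod : ph 0 * ph1 0 = -9 * (Real.sqrt 3 / (6*π)) := by
    rw [← hg]
    linear_combination (ph1 0) * hA - (3 * (Real.Gamma (4/3) / Real.Gamma (2/3) ^ 2)) * hB
  have hx0 : xs 0 = -1/8 := by norm_num [xs]
  have hrp := rr_pos (x := -1/8) le_rfl (by norm_num)
  have hz2 : 4 * (-1/8 : ℝ) * (1 - -1/8) = -9/16 := by norm_num
  have hS : PS tc (-9/16) = (rr (-1/8))^2 := by
    have := S_pos (zb (x := -1/8) le_rfl (by norm_num))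
    rw [rr, Real.sq_sqrt this.le, hz2]
  have e : ph 0 * ph1 0 = 405/128 * PS (DC tc) (-9/16) - 9/8 * (rr (-1/8))^2 := by
    simp only [ph, ph1, hx0, rd, xd, hz2]
    have hne := hrp.ne'
    generalize rr (-1/8) = r at *
    field_simp
    ring
  rw [hS]
  have hpi := Real.pi_ne_zero
  have hf : 4 * Real.sqrt 3 / (3*π) = -(8/9) * (-9 * (Real.sqrt 3 / (6*π))) := by
    field_simp; ring
  rw [hf, ← hprod, e]
  ring
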